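/- arXiv:2511.16562 — 2 statements merged into one kernel-verified Lean document; each statement's English description precedes it below -/
import Mathlib

section
/- There are no monomials of weight zero: for every n ≥ 0 and all integers i_0, …, i_n with 0 ≤ i_k ≤ s_k − 2 for each k, one has ∑_{k=0}^{n} i_k · d_{n,k} ≠ d_n; that is, the weight w(i_0,…,i_n) = d_n − ∑_{k=0}^n i_k d_{n,k} is never zero. -/
/-- The Sylvester sequence: `s 0 = 2`, `s (n+1) = 1 + s 0 * s 1 * ⋯ * s n`. -/
def syl : ℕ → ℕ
  | 0 => 2
  | n + 1 => 1 + ∏ k ∈ (Finset.range (n + 1)).attach, syl k.1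
decreasing_by exact Finset.mem_range.mp k.2

/-- `d n = ∏_{k=0}^{n} s k`. -/
def dS (n : ℕ) : ℕ := ∏ k ∈ Finset.range (n + 1), syl k

/-- `d⟨n,j⟩ = d n / s j`. -/
def dSj (n j : ℕ) : ℕ := dS n / syl j

theorem syl_succ (n : ℕ) : syl (n + 1) = dS n + 1 := by
  rw [syl, Finset.prod_attach (Finset.range (n + 1)) syl, dS, add_comm]

theorem two_le_syl (n : ℕ) : 2 ≤ syl n := by
  induction n using Nat.strong_induction_on with
  | _ n ih =>
    cases n with
    | zero => simp [syl]
    | succ n =>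
      have : 0 < dS n := Finset.prod_pos fun k hk =>
        zero_lt_two.trans_le (ih k (Finset.mem_range.mp hk))
      rw [syl_succ]
      omega

theorem syl_pos (n : ℕ) : 0 < syl n := zero_lt_two.trans_le (two_le_syl n)

theorem syl_dvd_dS {j n : ℕ} (h : j ≤ n) : syl j ∣ dS n :=
  Finset.dvd_prod_of_mem syl (Finset.mem_range_succ_iff.mpr h)

theorem coprime_syl_of_lt {j k : ℕ} (h : j < k) : (syl j).Coprime (syl k) := by
  obtain ⟨n, rfl⟩ := Nat.exists_eq_succ_of_ne_zero (Nat.ne_zero_of_lt h)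
  rw [Nat.succ_eq_add_one, syl_succ]
  exact ((Nat.coprime_self_add_right).mpr (Nat.coprime_one_right _)).coprime_dvd_left
    (syl_dvd_dS (Nat.lt_succ_iff.mp h))

theorem coprime_syl {j k : ℕ} (h : j ≠ k) : (syl j).Coprime (syl k) :=
  h.lt_or_gt.elim coprime_syl_of_lt fun h => (coprime_syl_of_lt h).symm

theorem dSj_eq_prod_erase {n j : ℕ} (h : j ≤ n) :
    dSj n j = ∏ k ∈ (Finset.range (n + 1)).erase j, syl k :=
  Nat.div_eq_of_eq_mul_right (syl_pos j)
    (Finset.mul_prod_erase _ syl (Finset.mem_range_succ_iff.mpr h)).symm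

theorem coprime_syl_dSj {n j : ℕ} (h : j ≤ n) : (syl j).Coprime (dSj n j) := by
  rw [dSj_eq_prod_erase h]
  exact Nat.Coprime.prod_right fun k hk => coprime_syl (Finset.ne_of_mem_erase hk).symm

theorem syl_dvd_dSj {n j k : ℕ} (hj : j ≤ n) (hk : k ≤ n) (hkj : k ≠ j) :
    syl k ∣ dSj n j := by
  rw [dSj_eq_prod_erase hj]
  exact Finset.dvd_prod_of_mem syl
    (Finset.mem_erase.mpr ⟨hkj, Finset.mem_range_succ_iff.mpr hk⟩)

/-- If the weight of a monomial is zero, each exponent is divisible by the corresponding term of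
the Sylvester sequence. -/
theorem syl_dvd_of_sum_eq {n : ℕ} {i : ℕ → ℕ}
    (h : ∑ k ∈ Finset.range (n + 1), i k * dSj n k = dS n) {k : ℕ} (hk : k ≤ n) :
    syl k ∣ i k := by
  refine (coprime_syl_dSj hk).dvd_of_dvd_mul_right ?_
  have hrest : syl k ∣ ∑ j ∈ (Finset.range (n + 1)).erase k, i j * dSj n j :=
    Finset.dvd_sum fun j hj =>
      (syl_dvd_dSj (Finset.mem_range_succ_iff.mp (Finset.mem_of_mem_erase hj)) hk
        (Finset.ne_of_mem_erase hj).symm).mul_left _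
  refine (Nat.dvd_add_left hrest).mp ?_
  rw [Finset.add_sum_erase _ (fun j => i j * dSj n j) (Finset.mem_range_succ_iff.mpr hk), h]
  exact syl_dvd_dS hk

/-- There are no monomials of weight zero: if `0 ≤ i_k ≤ s_k − 2` for all `0 ≤ k ≤ n`, then
`∑_{k=0}^{n} i_k d_{n,k} ≠ d_n`, i.e. the weight `w(i_0,…,i_n) = d_n − ∑ i_k d_{n,k}` is
never zero. -/
theorem no_weight_zero_monomials (n : ℕ) (i : ℕ → ℕ)
    (hi : ∀ k, k ≤ n → i k ≤ syl k - 2) :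
    ∑ k ∈ Finset.range (n + 1), i k * dSj n k ≠ dS n := by
  intro h
  have hzero : ∑ k ∈ Finset.range (n + 1), i k * dSj n k = 0 := by
    refine Finset.sum_eq_zero fun k hk => ?_
    have hkn := Finset.mem_range_succ_iff.mp hk
    have hlt : i k < syl k := by
      have := hi k hkn
      have := two_le_syl k
      omega
    rw [Nat.eq_zero_of_dvd_of_lt (syl_dvd_of_sum_eq h hkn) hlt, zero_mul]
  have hpos : 0 < dS n := Finset.prod_pos fun k _ => syl_pos k
  omega
end

section
/- Let n ≥ 1, d = d_n, a_i = d_{n,i} for 0 ≤ i ≤ n, and a_{n+1} = 1. Then the number of (n+2)-tuples of integers (k_0, …, k_n, k_{n+1}) with 0 ≤ k_i ≤ s_i − 2 for 0 ≤ i ≤ n, 0 ≤ k_{n+1} ≤ d − 2, and ∑_{i=0}^{n+1} k_i a_i = d, equals #{ (k_1,…,k_n) ∈ ℤ^n : 0 ≤ k_i ≤ s_i − 2 and ∑_{i=1}^{n} k_i/s_i ≤ 1 } − 1. -/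
theorem dS_pos (n : ℕ) : 0 < dS n :=
  Finset.prod_pos fun k _ => by linarith [two_le_syl k]

theorem dSj_mul_syl {n j : ℕ} (hj : j ≤ n) : dSj n j * syl j = dS n :=
  Nat.div_mul_cancel (Finset.dvd_prod_of_mem _ (Finset.mem_range.mpr (by omega)))

theorem two_dvd_dSj_succ {n j : ℕ} (hj : j < n) : 2 ∣ dSj n (j + 1) := by
  have h : syl 0 * syl (j + 1) ∣ dS n := by
    rw [← Finset.prod_pair (f := syl) (Nat.succ_ne_zero j).symm]
    apply Finset.prod_dvd_prod_of_subset
    intro x hx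
    simp only [Finset.mem_insert, Finset.mem_singleton] at hx
    simp only [Finset.mem_range]
    omega
  rw [mul_comm] at h
  have h2 : syl 0 = 2 := by simp [syl]
  exact h2 ▸ Nat.dvd_div_of_mul_dvd h

/-- The contribution of the middle weights `d⟨n,1⟩, …, d⟨n,n⟩` to the degree. -/
def middleSum {n : ℕ} (k : Fin n → ℕ) : ℕ := ∑ i : Fin n, k i * dSj n (i + 1)

theorem two_dvd_middleSum {n : ℕ} (k : Fin n → ℕ) : 2 ∣ middleSum k :=
  Finset.dvd_sum fun i _ => (two_dvd_dSj_succ i.2).mul_left _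

theorem middleSum_eq_zero {n : ℕ} {k : Fin n → ℕ} : middleSum k = 0 ↔ k = 0 := by
  have h (i : Fin n) : dSj n (i + 1) ≠ 0 := fun h0 => by
    have := dSj_mul_syl (n := n) (j := i + 1) i.2
    rw [h0, zero_mul] at this
    exact (dS_pos n).ne this
  simp [middleSum, funext_iff, h]

theorem sum_div_syl_le_one_iff {n : ℕ} (k : Fin n → ℕ) :
    (∑ i : Fin n, (k i : ℚ) / (syl ((i : ℕ) + 1) : ℚ)) ≤ 1 ↔ middleSum k ≤ dS n := by
  have hd : (0 : ℚ) < dS n := by exact_mod_cast dS_pos n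
  have h : (∑ i : Fin n, (k i : ℚ) / (syl ((i : ℕ) + 1) : ℚ)) = middleSum k / dS n := by
    rw [middleSum, Nat.cast_sum, Finset.sum_div]
    refine Finset.sum_congr rfl fun i _ => ?_
    have hs : (syl ((i : ℕ) + 1) : ℚ) ≠ 0 := by
      have := two_le_syl ((i : ℕ) + 1)
      positivity
    have hi : (dSj n (i + 1) : ℚ) * syl ((i : ℕ) + 1) = dS n := by
      exact_mod_cast dSj_mul_syl (n := n) (j := i + 1) i.2
    rw [div_eq_div_iff hs hd.ne', ← hi]
    push_cast
    ring
  rw [h, div_le_one hd, Nat.cast_le]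

theorem sum_weights_eq {n : ℕ} (k : Fin (n + 2) → ℕ) :
    (∑ i : Fin (n + 2), k i * (if (i : ℕ) ≤ n then dSj n i else 1)) =
      k 0 * dSj n 0 + (middleSum (fun i : Fin n => k i.castSucc.succ) + k (Fin.last (n + 1))) := by
  rw [Fin.sum_univ_succ, Fin.sum_univ_castSucc]
  simp [middleSum]

/-- A solution of the degree equation is determined by its middle coordinates. -/
def solutionEquiv (n : ℕ) :
    {k : Fin (n + 2) → ℕ //
        (∀ i : Fin (n + 2), (i : ℕ) ≤ n → k i ≤ syl i - 2) ∧
        k (Fin.last (n + 1)) ≤ dS n - 2 ∧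
        (∑ i : Fin (n + 2), k i * (if (i : ℕ) ≤ n then dSj n i else 1)) = dS n} ≃
      ↥({k : Fin n → ℕ | (∀ i : Fin n, k i ≤ syl ((i : ℕ) + 1) - 2) ∧
        (∑ i : Fin n, (k i : ℚ) / (syl ((i : ℕ) + 1) : ℚ)) ≤ 1} \ {0}) where
  toFun k := ⟨fun i => k.1 i.castSucc.succ, by
    obtain ⟨k, hk, hlast, hsum⟩ := k
    rw [sum_weights_eq] at hsum
    refine ⟨⟨fun i => by simpa using hk i.castSucc.succ (by simp), ?_⟩, ?_⟩
    · rw [sum_div_syl_le_one_iff]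
      dsimp only
      omega
    · rw [Set.mem_singleton_iff, ← middleSum_eq_zero]
      have h0 : k 0 = 0 := by simpa [syl] using hk 0
      have := dS_pos n
      rw [h0, zero_mul] at hsum
      dsimp only
      omega⟩
  invFun k := ⟨Fin.cons 0 (Fin.snoc (α := fun _ => ℕ) k.1 (dS n - middleSum k.1)), by
    obtain ⟨k, ⟨hk, hle⟩, hne⟩ := k
    rw [sum_div_syl_le_one_iff] at hle
    rw [Set.mem_singleton_iff, ← middleSum_eq_zero] at hne
    have h2 := two_dvd_middleSum k
    refine ⟨fun i => ?_, ?_, ?_⟩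
    · induction i using Fin.cases with
      | zero => simp
      | succ i =>
        induction i using Fin.lastCases with
        | last => simp
        | cast i => simpa using hk i
    · rw [← Fin.succ_last, Fin.cons_succ, Fin.snoc_last]
      dsimp only
      omega
    · rw [sum_weights_eq, ← Fin.succ_last]
      simp only [Fin.cons_zero, Fin.cons_succ, Fin.snoc_castSucc, Fin.snoc_last, zero_mul]
      change 0 + (middleSum k + (dS n - middleSum k)) = dS n
      omega⟩
  left_inv k := by
    obtain ⟨k, hk, hlast, hsum⟩ := k
    rw [sum_weights_eq] at hsum
    have h0 : k 0 = 0 := by simpa [syl] using hk 0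
    rw [h0, zero_mul] at hsum
    ext i
    induction i using Fin.cases with
    | zero => simp [h0]
    | succ i =>
      induction i using Fin.lastCases with
      | last =>
        simp only [Fin.cons_succ, Fin.snoc_last]
        change _ = k (Fin.last (n + 1))
        omega
      | cast i => simp
  right_inv k := by
    ext i
    simp

/-- With `d = d_n`, `a_i = d_{n,i}` for `0 ≤ i ≤ n` and `a_{n+1} = 1`: the number of
`(n+2)`-tuples `(k_0, …, k_{n+1})` with `0 ≤ k_i ≤ s_i − 2` for `i ≤ n`,
`0 ≤ k_{n+1} ≤ d − 2`, and `∑ k_i a_i = d`, equals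
`#{(k_1,…,k_n) : 0 ≤ k_i ≤ s_i − 2, ∑ k_i/s_i ≤ 1} − 1`. -/
theorem count_N_zero (n : ℕ) (hn : 1 ≤ n) :
    Nat.card {k : Fin (n + 2) → ℕ //
        (∀ i : Fin (n + 2), (i : ℕ) ≤ n → k i ≤ syl i - 2) ∧
        k (Fin.last (n + 1)) ≤ dS n - 2 ∧
        (∑ i : Fin (n + 2), k i * (if (i : ℕ) ≤ n then dSj n i else 1)) = dS n} =
    Nat.card {k : Fin n → ℕ //
        (∀ i : Fin n, k i ≤ syl ((i : ℕ) + 1) - 2) ∧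
        (∑ i : Fin n, (k i : ℚ) / (syl ((i : ℕ) + 1) : ℚ)) ≤ 1} - 1 := by
  rw [Nat.card_congr (solutionEquiv n), Nat.card_coe_set_eq]
  refine Set.ncard_sdiff_singleton_of_mem ⟨fun i => Nat.zero_le _, ?_⟩
  simp
end
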